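/- Let x ∈ ℝ^N be a Bernoulli–Gaussian random vector with parameter θ ∈ (0,1). If d ∈ S^{N−1} lies in S' = { (1/√k) v : v ∈ {−1,0,1}^N, ‖v‖₀ = k } for some k ∈ {1,…,N}, then 𝔼[(dᵀx)|dᵀx| x] is a positive scalar multiple of d; moreover the scalar depends only on θ and k (it equals γ₃ θ Σ-type combinatorial expression in θ and k), so every point of S' is an eigenvector of the population gradient map and hence a Riemannian stationary point. -/

import Mathlib

open MeasureTheory ProbabilityTheory Real

/-- The Bernoulli–Gaussian distribution BG(θ) on ℝ. -/
noncomputable def bgMeasure (θ : ℝ) : Measure ℝ :=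
  (1 - θ).toNNReal • Measure.dirac 0 + θ.toNNReal • gaussianReal 0 1

instance (θ : ℝ) : IsFiniteMeasure (bgMeasure θ) := by
  unfold bgMeasure; infer_instance

/-- The law of a Bernoulli–Gaussian random vector x ∈ ℝ^N with i.i.d. BG(θ) coordinates. -/
noncomputable def bgPi (θ : ℝ) (N : ℕ) : Measure (Fin N → ℝ) :=
  Measure.pi fun _ => bgMeasure θ

/-- 𝔼[(dᵀx)|dᵀx| x_j] for x ~ BG(θ)^N (the population gradient map, up to a factor −3). -/
noncomputable def popG (θ : ℝ) (N : ℕ) (d : Fin N → ℝ) (j : Fin N) : ℝ :=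
  ∫ x, (∑ i, d i * x i) * |∑ i, d i * x i| * x j ∂ bgPi θ N

lemma bg_prob {θ : ℝ} (h : θ ∈ Set.Ioo (0 : ℝ) 1) : IsProbabilityMeasure (bgMeasure θ) := by
  obtain ⟨h0, h1⟩ := h
  constructor
  have : (1 - θ).toNNReal + θ.toNNReal = 1 := by
    rw [← Real.toNNReal_add (by linarith) h0.le]; simp
  simp only [bgMeasure, Measure.add_apply, Measure.smul_apply, measure_univ]
  rw [← add_smul, this, one_smul]

lemma bg_neg (θ : ℝ) : (bgMeasure θ).map (fun x => -x) = bgMeasure θ := by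
  have hm : Measurable (fun x : ℝ => -x) := measurable_neg
  simp only [bgMeasure]
  rw [Measure.map_add _ _ hm, Measure.map_smul, Measure.map_smul,
    gaussianReal_map_neg, Measure.map_dirac' hm]
  simp

lemma bg_sign (θ : ℝ) {s : ℝ} (hs : s = 1 ∨ s = -1) :
    (bgMeasure θ).map (fun x => s * x) = bgMeasure θ := by
  rcases hs with rfl | rfl
  · simp
  · simpa using bg_neg θ

lemma bg_T {θ : ℝ} (h : θ ∈ Set.Ioo (0 : ℝ) 1) {k N : ℕ} (e : Fin k → Fin N)
    (he : Function.Injective e) (s : Fin k → ℝ) (hs : ∀ a, s a = 1 ∨ s a = -1) :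
    (bgPi θ N).map (fun x a => s a * x (e a)) = bgPi θ k := by
  have := bg_prob h
  have : IsProbabilityMeasure (bgPi θ N) := by unfold bgPi; infer_instance
  have h1 : iIndepFun (fun (i : Fin N) (x : Fin N → ℝ) => x i) (bgPi θ N) :=
    iIndepFun_pi (μ := fun _ => bgMeasure θ) (X := fun _ x => x) (fun _ => aemeasurable_id)
  have h2 := (h1.precomp he).comp (fun a x => s a * x) (fun a => by fun_prop)
  rw [iIndepFun_iff_map_fun_eq_pi_map] at h2
  · refine h2.trans ?_
    unfold bgPi
    congr 1
    ext1 a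
    have h3 : (Measure.pi fun _ : Fin N => bgMeasure θ).map (fun x => x (e a)) = bgMeasure θ :=
      (measurePreserving_eval (fun _ => bgMeasure θ) (e a)).map_eq
    conv_rhs => rw [← bg_sign θ (hs a), ← h3]
    rw [Measure.map_map (by fun_prop) (by fun_prop)]
  · intro a
    have : Measurable (fun x : Fin N → ℝ => s a * x (e a)) := by fun_prop
    exact this.aemeasurable

lemma bg_memLp (θ : ℝ) : MemLp (fun x : ℝ => x) 3 (bgMeasure θ) := by
  rw [← integrable_norm_rpow_iff (by fun_prop) (by norm_num) (by norm_num)]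
  unfold bgMeasure
  refine Integrable.add_measure ?_ ?_
  · exact Integrable.smul_measure_nnreal (integrable_dirac (by simp))
  · refine Integrable.smul_measure_nnreal ?_
    rw [integrable_norm_rpow_iff (by fun_prop) (by norm_num) (by norm_num)]
    exact memLp_id_gaussianReal 3

lemma bg_memLp_coord {θ : ℝ} (h : θ ∈ Set.Ioo (0 : ℝ) 1) (N : ℕ) (j : Fin N) :
    MemLp (fun x : Fin N → ℝ => x j) 3 (bgPi θ N) := by
  have := bg_prob h
  exact (bg_memLp θ).comp_measurePreserving (measurePreserving_eval (fun _ => bgMeasure θ) j)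

lemma bg_int_cube {N : ℕ} {θ : ℝ} {f : (Fin N → ℝ) → ℝ} (hf : MemLp f 3 (bgPi θ N)) :
    Integrable (fun x => |f x| ^ 3) (bgPi θ N) := by
  have := hf.integrable_norm_pow (p := 3) (by norm_num)
  simpa using this

lemma bg_memLp_sum {θ : ℝ} (h : θ ∈ Set.Ioo (0 : ℝ) 1) (N : ℕ) (d : Fin N → ℝ) :
    MemLp (fun x : Fin N → ℝ => ∑ i, d i * x i) 3 (bgPi θ N) :=
  memLp_finsetSum _ fun i _ => (bg_memLp_coord h N i).const_mul (d i)

lemma bg_int {θ : ℝ} (h : θ ∈ Set.Ioo (0 : ℝ) 1) (N : ℕ) (d : Fin N → ℝ) (j : Fin N) :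
    Integrable (fun x : Fin N → ℝ => (∑ i, d i * x i) * |∑ i, d i * x i| * x j) (bgPi θ N) := by
  refine ((bg_int_cube (bg_memLp_sum h N d)).add (bg_int_cube (bg_memLp_coord h N j))).mono'
    (by fun_prop) (Filter.Eventually.of_forall fun x => ?_)
  simp only [Real.norm_eq_abs, abs_mul, abs_abs, Pi.add_apply]
  set a := |∑ i, d i * x i|
  set b := |x j|
  have ha : 0 ≤ a := abs_nonneg _
  have hb : 0 ≤ b := abs_nonneg _
  rcases le_total a b with hab | hab
  · have : a * a * b ≤ b * b * b := by gcongr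
    nlinarith [pow_nonneg ha 3]
  · have : a * a * b ≤ a * a * a := by gcongr
    nlinarith [pow_nonneg hb 3]

lemma bg_sum_popG {θ : ℝ} (h : θ ∈ Set.Ioo (0 : ℝ) 1) (N : ℕ) (d : Fin N → ℝ) :
    ∑ l, d l * popG θ N d l = ∫ x, |∑ i, d i * x i| ^ 3 ∂ bgPi θ N := by
  simp only [popG, ← integral_const_mul]
  rw [← integral_finsetSum _ fun l _ => (bg_int h N d l).const_mul (d l)]
  refine integral_congr_ae (Filter.Eventually.of_forall fun x => ?_)
  have : ∀ S : ℝ, |S| ^ 3 = S * |S| * S := by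
    intro S
    have := abs_mul_abs_self S
    calc |S| ^ 3 = |S| * (|S| * |S|) := by ring
      _ = _ := by rw [this]; ring
  simp only [this]
  rw [Finset.mul_sum]
  exact Finset.sum_congr rfl fun l _ => by ring

lemma bg_Ioi {θ : ℝ} (h : θ ∈ Set.Ioo (0 : ℝ) 1) : 0 < bgMeasure θ (Set.Ioi 0) := by
  have hg : 0 < gaussianReal 0 1 (Set.Ioi 0) := by
    rw [pos_iff_ne_zero]
    intro h0
    have := (gaussianReal_absolutelyContinuous' 0 (v := 1) one_ne_zero) h0
    simp at this
  have : 0 < θ.toNNReal := by simpa using h.1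
  simp only [bgMeasure, Measure.add_apply, Measure.smul_apply]
  refine lt_of_lt_of_le ?_ le_add_self
  rw [ENNReal.smul_def, smul_eq_mul]
  exact ENNReal.mul_pos (by simpa using h.1) hg.ne'

lemma bg_pos {θ : ℝ} (h : θ ∈ Set.Ioo (0 : ℝ) 1) (N : ℕ) (hN : 1 ≤ N) (c : ℝ) (hc : 0 < c) :
    0 < ∫ x, |∑ i : Fin N, c * x i| ^ 3 ∂ bgPi θ N := by
  rw [integral_pos_iff_support_of_nonneg (fun x => by positivity)
    (bg_int_cube (bg_memLp_sum h N fun _ => c))]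
  have hbox : 0 < bgPi θ N (Set.univ.pi fun _ => Set.Ioi 0) := by
    unfold bgPi
    rw [Measure.pi_pi, pos_iff_ne_zero, Finset.prod_ne_zero_iff]
    exact fun _ _ => (bg_Ioi h).ne'
  refine hbox.trans_le (measure_mono fun x hx => ?_)
  have : Nonempty (Fin N) := ⟨⟨0, hN⟩⟩
  have : 0 < ∑ i : Fin N, c * x i :=
    Finset.sum_pos (fun i _ => mul_pos hc (hx i trivial)) Finset.univ_nonempty
  simp only [Function.mem_support]
  positivity

lemma popG_T {θ : ℝ} (h : θ ∈ Set.Ioo (0 : ℝ) 1) {k N : ℕ} (e : Fin k → Fin N)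
    (he : Function.Injective e) (s : Fin k → ℝ) (hs : ∀ a, s a = 1 ∨ s a = -1)
    (d : Fin N → ℝ) (c : Fin k → ℝ)
    (hd : ∀ x : Fin N → ℝ, ∑ i, d i * x i = ∑ a, c a * (s a * x (e a))) (a : Fin k) :
    popG θ N d (e a) = s a * popG θ k c a := by
  have hT := bg_T h e he s hs
  have hm : Measurable (fun (x : Fin N → ℝ) a => s a * x (e a)) := by fun_prop
  rw [popG, popG, ← hT, integral_map hm.aemeasurable (by fun_prop),
    ← integral_const_mul]
  refine integral_congr_ae (Filter.Eventually.of_forall fun x => ?_)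
  have hss : s a * s a = 1 := by rcases hs a with h | h <;> simp [h]
  simp only [hd]
  linear_combination (-((∑ a, c a * (s a * x (e a))) * |∑ a, c a * (s a * x (e a))| * x (e a))) * hss

open scoped Classical in
theorem stmt7 :
    ∃ χ : ℝ → ℕ → ℝ,
      ∀ (N : ℕ) (θ : ℝ), θ ∈ Set.Ioo (0 : ℝ) 1 →
      ∀ k ∈ Finset.Icc 1 N, ∀ v : Fin N → ℝ,
        (∀ i, v i = -1 ∨ v i = 0 ∨ v i = 1) →
        (Finset.univ.filter fun i => v i ≠ 0).card = k →
        ∀ d : Fin N → ℝ, (∀ i, d i = v i / Real.sqrt k) →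
          0 < χ θ k ∧
          (∀ j, popG θ N d j = χ θ k * d j) ∧
          (∀ j, popG θ N d j - d j * ∑ l, d l * popG θ N d l = 0) := by
  refine ⟨fun θ k => ∑ l, (1 / √k) * popG θ k (fun _ => 1 / √k) l, ?_⟩
  intro N θ hθ k hk v hv hcard d hd
  have hk1 : 1 ≤ k := (Finset.mem_Icc.1 hk).1
  have hkpos : (0 : ℝ) < k := by exact_mod_cast hk1
  have hsq : 0 < √(k : ℝ) := Real.sqrt_pos.2 hkpos
  have hsqk : √(k : ℝ) * √(k : ℝ) = k := Real.mul_self_sqrt hkpos.le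
  have hmain : ∀ j, popG θ N d j
      = (∑ l, (1 / √k) * popG θ k (fun _ => 1 / √k) l) * d j := by
    intro j
    by_cases hj : v j = 0
    · -- sign flip at j
      have hdj : d j = 0 := by rw [hd, hj, zero_div]
      have := popG_T hθ (id : Fin N → Fin N) Function.injective_id
        (fun i => if i = j then -1 else 1) (fun a => by by_cases a = j <;> simp [*]) d d
        (fun x => Finset.sum_congr rfl fun i _ => by
          by_cases hi : i = j
          · simp [hi, hdj]
          · simp [hi]) j
      simp only [id, if_true] at this
      rw [hdj, mul_zero]
      linarith
    · let E := (Finset.univ.filter fun i => v i ≠ 0).equivFinOfCardEq hcard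
      let e : Fin k → Fin N := fun a => (E.symm a : Fin N)
      have he : Function.Injective e := Subtype.val_injective.comp E.symm.injective
      have hev : ∀ a, v (e a) ≠ 0 := fun a => (Finset.mem_filter.1 (E.symm a).2).2
      have hj' : j ∈ Finset.univ.filter fun i => v i ≠ 0 := by simpa using hj
      obtain ⟨a, ha⟩ : ∃ a, e a = j := ⟨E ⟨j, hj'⟩, by simp [e]⟩
      have h1 := popG_T hθ e he (fun a => v (e a))
        (fun a => by have := hv (e a); have := hev a; tauto) d (fun _ => 1 / √k)
        (fun x => by
          rw [← Finset.sum_subset (Finset.filter_subset (fun i => v i ≠ 0) Finset.univ)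
            (fun i _ hi => by
              have : v i = 0 := by simpa using hi
              simp [hd, this])]
          rw [← Finset.sum_coe_sort, ← E.symm.sum_comp]
          refine Finset.sum_congr rfl fun b _ => ?_
          simp only [hd, e]; ring) a
      have h2 : ∀ l, popG θ k (fun _ => 1 / √k) l = popG θ k (fun _ => 1 / √k) a := by
        intro l
        have := popG_T hθ (Equiv.swap a l) (Equiv.injective _) (fun _ => 1) (fun _ => Or.inl rfl)
          (fun _ => 1 / √k) (fun _ => 1 / √k)
          (fun x => by
            rw [← Equiv.sum_comp (Equiv.swap a l) (fun i => 1 / √k * x i)]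
            simp) a
        simpa using this
      rw [Finset.sum_congr rfl fun l _ => by rw [h2 l]]
      rw [ha] at h1
      rw [h1, hd]
      simp only [Finset.sum_const, Finset.card_univ, Fintype.card_fin, nsmul_eq_mul]
      field_simp
      rw [sq, hsqk]
      ring
  have hnorm : ∑ l, d l * d l = 1 := by
    have : ∀ l, d l * d l = (if v l ≠ 0 then 1 else 0) / (k : ℝ) := by
      intro l
      rw [hd, div_mul_div_comm, hsqk]
      rcases hv l with h | h | h <;> simp [h]
    simp only [this]
    rw [← Finset.sum_div, Finset.sum_boole, hcard, div_self hkpos.ne']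
  refine ⟨?_, hmain, fun j => ?_⟩
  · have := bg_sum_popG hθ k (fun _ => 1 / √k)
    simp only at this ⊢
    rw [this]
    exact bg_pos hθ k hk1 _ (by positivity)
  · simp only [hmain]
    generalize (∑ l, (1 / √k) * popG θ k (fun _ => 1 / √k) l) = X
    have : ∑ l, d l * (X * d l) = X := by
      calc ∑ l, d l * (X * d l) = X * ∑ l, d l * d l := by
            rw [Finset.mul_sum]
            exact Finset.sum_congr rfl fun l _ => by ring
        _ = X := by rw [hnorm, mul_one]
    rw [this]; ring
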